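/- arXiv:0912.0787 — 2 statements merged into one kernel-verified Lean document; each statement's English description precedes it below -/
import Mathlib

section
/- Let g : S^n → ℝ^n be any continuous map. Then there exists x ∈ S^n with g(-x) = g(x). -/
namespace BU

set_option linter.unusedSectionVars false

/-- Chains mod 2 on ordered simplices (lists of points). -/
abbrev Ch (E : Type*) := List E →₀ ZMod 2

section alg
variable {E : Type*}

theorem ch_add_self (c : Ch E) : c + c = 0 := by
  ext l; simpa using CharTwo.add_self_eq_zero (c l)

noncomputable def lift {M : Type*} [AddCommGroup M] [Module (ZMod 2) M] (f : List E → M) :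
    Ch E →ₗ[ZMod 2] M := Finsupp.linearCombination (ZMod 2) f

@[simp] theorem lift_single {M : Type*} [AddCommGroup M] [Module (ZMod 2) M] (f : List E → M)
    (l : List E) : lift f (Finsupp.single l 1) = f l := by
  simp [lift]

theorem hom_ext {M : Type*} [AddCommGroup M] [Module (ZMod 2) M] {f g : Ch E →ₗ[ZMod 2] M}
    (h : ∀ l, f (Finsupp.single l 1) = g (Finsupp.single l 1)) : f = g := by
  refine Finsupp.lhom_ext' fun l => LinearMap.ext_ring ?_
  simpa using h l

noncomputable def cone (v : E) : Ch E →ₗ[ZMod 2] Ch E :=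
  lift fun l => Finsupp.single (v :: l) 1

@[simp] theorem cone_single (v : E) (l : List E) :
    cone v (Finsupp.single l 1) = Finsupp.single (v :: l) 1 := by simp [cone]

noncomputable def bdL : List E → Ch E
  | [] => 0
  | v :: l => Finsupp.single l 1 + cone v (bdL l)

noncomputable def bd : Ch E →ₗ[ZMod 2] Ch E := lift bdL

@[simp] theorem bd_nil : bd (Finsupp.single ([] : List E) 1) = 0 := by simp [bd, bdL]

theorem bd_cons (v : E) (l : List E) : bd (Finsupp.single (v :: l) 1) =
    Finsupp.single l 1 + cone v (bd (Finsupp.single l 1)) := by simp [bd, bdL]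

theorem bd_cone (v : E) (c : Ch E) : bd (cone v c) = c + cone v (bd c) := by
  have : bd ∘ₗ cone v = LinearMap.id + cone v ∘ₗ bd := by
    apply hom_ext; intro l; simp [bd_cons]
  exact LinearMap.congr_fun this c

theorem bd_bd (c : Ch E) : bd (bd c) = 0 := by
  have : (bd ∘ₗ bd : Ch E →ₗ[ZMod 2] Ch E) = 0 := by
    apply hom_ext; intro l
    induction l with
    | nil => simp
    | cons v l ih =>
      simp only [LinearMap.comp_apply, LinearMap.zero_apply] at ih ⊢
      rw [bd_cons, map_add, bd_cone, ih, map_zero, add_zero, ch_add_self]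
  exact LinearMap.congr_fun this c

/-- supported chains -/
theorem supp_map {P : Set (List E)} {M : Type*} [AddCommGroup M] [Module (ZMod 2) M]
    (f : Ch E →ₗ[ZMod 2] M) (N : Submodule (ZMod 2) M)
    (h : ∀ l ∈ P, f (Finsupp.single l 1) ∈ N) {c : Ch E}
    (hc : c ∈ Finsupp.supported (ZMod 2) (ZMod 2) P) : f c ∈ N := by
  rw [Finsupp.supported_eq_span_single] at hc
  have : Submodule.span (ZMod 2) ((fun i => Finsupp.single i (1 : ZMod 2)) '' P) ≤ N.comap f := by
    rw [Submodule.span_le]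
    rintro _ ⟨l, hl, rfl⟩
    exact h l hl
  exact this hc

/-! subdivision -/
noncomputable def sd (b : List E → E) : ℕ → (Ch E →ₗ[ZMod 2] Ch E)
  | 0 => LinearMap.id
  | k + 1 => lift fun l => cone (b l) (sd b k (bd (Finsupp.single l 1)))

theorem sd_succ_single (b : List E → E) (k : ℕ) (l : List E) :
    sd b (k + 1) (Finsupp.single l 1) = cone (b l) (sd b k (bd (Finsupp.single l 1))) := by
  simp [sd]

theorem bd_sd (b : List E → E) (k : ℕ) (c : Ch E) : bd (sd b (k + 1) c) = sd b k (bd c) := by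
  have : bd ∘ₗ sd b (k + 1) = sd b k ∘ₗ bd := by
    induction k with
    | zero =>
      apply hom_ext; intro l
      simp only [LinearMap.comp_apply, sd_succ_single, bd_cone]
      simp [sd, bd_bd]
    | succ k ih =>
      apply hom_ext; intro l
      simp only [LinearMap.comp_apply] at ih ⊢
      rw [sd_succ_single, bd_cone]
      have h2 := LinearMap.congr_fun ih (bd (Finsupp.single l 1))
      simp only [LinearMap.comp_apply] at h2
      rw [h2, bd_bd]; simp
  exact LinearMap.congr_fun this c

/-! antipode -/
variable [AddCommGroup E]

noncomputable def tau : Ch E →ₗ[ZMod 2] Ch E :=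
  lift fun l => Finsupp.single (l.map (fun x => -x)) 1

@[simp] theorem tau_single (l : List E) :
    tau (Finsupp.single l 1) = Finsupp.single (l.map (fun x => -x)) 1 := by simp [tau]

theorem tau_tau (c : Ch E) : tau (tau c) = c := by
  have : (tau ∘ₗ tau : Ch E →ₗ[ZMod 2] Ch E) = LinearMap.id := by
    apply hom_ext; intro l; simp
  exact LinearMap.congr_fun this c

theorem tau_cone (v : E) (c : Ch E) : tau (cone v c) = cone (-v) (tau c) := by
  have : tau ∘ₗ cone v = cone (-v) ∘ₗ tau := by
    apply hom_ext; intro l; simp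
  exact LinearMap.congr_fun this c

theorem tau_bd (c : Ch E) : tau (bd c) = bd (tau c) := by
  have : (tau ∘ₗ bd : Ch E →ₗ[ZMod 2] Ch E) = bd ∘ₗ tau := by
    apply hom_ext; intro l
    induction l with
    | nil => simp
    | cons v l ih =>
      simp only [LinearMap.comp_apply, tau_single, List.map_cons] at ih ⊢
      rw [bd_cons, bd_cons, map_add, tau_cone, ih, tau_single]
  exact LinearMap.congr_fun this c

theorem tau_sd (b : List E → E) (hb : ∀ l, b (l.map (fun x => -x)) = - b l) (k : ℕ) (c : Ch E) :
    tau (sd b k c) = sd b k (tau c) := by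
  have : tau ∘ₗ sd b k = sd b k ∘ₗ tau := by
    induction k with
    | zero => rfl
    | succ k ih =>
      apply hom_ext; intro l
      have h2 := LinearMap.congr_fun ih (bd (Finsupp.single l 1))
      simp only [LinearMap.comp_apply] at h2
      simp only [LinearMap.comp_apply, tau_single]
      rw [sd_succ_single, sd_succ_single, tau_cone, h2, hb, tau_bd, tau_single]
  exact LinearMap.congr_fun this c

/-! the initial chains -/
noncomputable def ini (e : ℕ → E) : ℕ → Ch E
  | 0 => Finsupp.single [e 0] 1
  | k + 1 => cone (e (k + 1)) (ini e k + tau (ini e k))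

theorem bd_ini (e : ℕ → E) (k : ℕ) : bd (ini e (k + 1)) = ini e k + tau (ini e k) := by
  rw [ini, bd_cone]
  have : bd (ini e k + tau (ini e k)) = 0 := by
    rw [map_add, ← tau_bd]
    cases k with
    | zero => simp [ini, bd_cons, ch_add_self]
    | succ k =>
      rw [bd_ini e k, map_add, tau_tau, add_comm (tau _) (ini e k), ch_add_self]
  rw [this]; simp

/-- iterated subdivision of the initial chains -/
noncomputable def D (b : List E → E) (e : ℕ → E) (m k : ℕ) : Ch E :=
  (sd b (k + 1))^[m] (ini e k)

theorem bd_D (b : List E → E) (hb : ∀ l, b (l.map (fun x => -x)) = - b l) (e : ℕ → E) (m k : ℕ) :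
    bd (D b e m (k + 1)) = D b e m k + tau (D b e m k) := by
  unfold D
  induction m with
  | zero => simpa using bd_ini e k
  | succ m ih =>
    rw [Function.iterate_succ_apply', bd_sd, ih, Function.iterate_succ_apply', map_add, tau_sd b hb]

/-! the cochains -/
def hd (s : E → ZMod 2) : List E → ZMod 2
  | [] => 0
  | v :: _ => s v

def gaL (s : ℕ → E → ZMod 2) : ℕ → List E → ZMod 2
  | 0, [_] => 1
  | 0, _ => 0
  | _ + 1, [] => 0
  | k + 1, v :: m => (s k v + hd (s k) m) * gaL s k m

noncomputable def ga (s : ℕ → E → ZMod 2) (k : ℕ) : Ch E →ₗ[ZMod 2] ZMod 2 := lift (gaL s k)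
noncomputable def al (s : ℕ → E → ZMod 2) (k : ℕ) : Ch E →ₗ[ZMod 2] ZMod 2 :=
  lift fun l => hd (s k) l * gaL s k l

theorem ga_cone (s : ℕ → E → ZMod 2) (k : ℕ) (v : E) (c : Ch E) :
    ga s (k + 1) (cone v c) = s k v * ga s k c + al s k c := by
  have : ga s (k + 1) ∘ₗ cone v = s k v • ga s k + al s k := by
    apply hom_ext; intro l; simp [ga, al, gaL]; ring
  simpa using LinearMap.congr_fun this c

theorem al_cone (s : ℕ → E → ZMod 2) (k : ℕ) (v : E) (c : Ch E) :
    al s k (cone v c) = s k v * ga s k (cone v c) := by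
  have : al s k ∘ₗ cone v = s k v • (ga s k ∘ₗ cone v) := by
    apply hom_ext; intro l; simp [ga, al, hd]
  simpa using LinearMap.congr_fun this c

theorem gaL_nil (s : ℕ → E → ZMod 2) (k : ℕ) : gaL s k [] = 0 := by cases k <;> rfl

theorem al_bd_of (s : ℕ → E → ZMod 2) (k : ℕ) (h : ∀ c, ga s k (bd c) = 0) (c : Ch E) :
    al s k (bd c) = ga s (k + 1) c := by
  have : al s k ∘ₗ bd = ga s (k + 1) := by
    apply hom_ext; intro l
    cases l with
    | nil => simp [ga, gaL]
    | cons v m =>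
      have h1 := h (Finsupp.single (v :: m) 1)
      rw [bd_cons, map_add] at h1
      have h2 : ga s k (cone v (bd (Finsupp.single m 1))) = ga s k (Finsupp.single m 1) := by
        rw [CharTwo.add_eq_zero] at h1; exact h1.symm
      rw [LinearMap.comp_apply, bd_cons, map_add, al_cone, h2, ← cone_single, ga_cone, add_comm]
  exact LinearMap.congr_fun this c

theorem ga_bd (s : ℕ → E → ZMod 2) (k : ℕ) (c : Ch E) : ga s k (bd c) = 0 := by
  have : ga s k ∘ₗ bd = 0 := by
    induction k generalizing c with
    | zero =>
      have h0 : ∀ v w : E, ∀ c, ga s 0 (cone v (cone w c)) = 0 := by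
        intro v w c
        have : ga s 0 ∘ₗ cone v ∘ₗ cone w = 0 := by
          apply hom_ext; intro l; simp [ga, gaL]
        simpa using LinearMap.congr_fun this c
      apply hom_ext; intro l
      rcases l with _ | ⟨v, _ | ⟨w, l⟩⟩
      · simp
      · simp [bd_cons, ga, gaL]
      · simp only [LinearMap.comp_apply, bd_cons, map_add, h0]
        rcases l with _ | ⟨x, l⟩ <;> simp [ga, gaL, CharTwo.add_self_eq_zero]
    | succ k ih =>
      have h : ∀ c, ga s k (bd c) = 0 := fun c => LinearMap.congr_fun (ih c) c
      apply hom_ext; intro l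
      cases l with
      | nil => simp
      | cons v m =>
        rw [LinearMap.comp_apply, bd_cons, map_add, ga_cone, h, al_bd_of s k h]
        simp [CharTwo.add_self_eq_zero]
  exact LinearMap.congr_fun this c

theorem al_bd (s : ℕ → E → ZMod 2) (k : ℕ) (c : Ch E) :
    al s k (bd c) = ga s (k + 1) c := al_bd_of s k (ga_bd s k) c

theorem gaL_neg (s : ℕ → E → ZMod 2) (k : ℕ) (l : List E)
    (hs : ∀ j, ∀ v ∈ l, s j (-v) = s j v + 1) : gaL s k (l.map (fun x => -x)) = gaL s k l := by
  induction k generalizing l with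
  | zero => rcases l with _ | ⟨v, _ | ⟨w, l⟩⟩ <;> simp [gaL]
  | succ k ih =>
    rcases l with _ | ⟨v, _ | ⟨w, l⟩⟩
    · simp [gaL]
    · simp [gaL, gaL_nil]
    · have h := ih (w :: l) (fun j u hu => hs j u (List.mem_cons_of_mem _ hu))
      simp only [List.map_cons] at h ⊢
      simp only [gaL, hd, h]
      rw [hs k v (by simp), hs k w (by simp)]
      have : (1 + 1 : ZMod 2) = 0 := rfl
      linear_combination (gaL s k (w :: l)) * this

theorem al_tau (s : ℕ → E → ZMod 2) (k : ℕ) {c : Ch E}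
    (hc : c ∈ Finsupp.supported (ZMod 2) (ZMod 2)
      {l : List E | ∀ v ∈ l, ∀ j, s j (-v) = s j v + 1}) :
    al s k (c + tau c) = ga s k c := by
  have := supp_map (al s k + al s k ∘ₗ tau - ga s k) ⊥ (fun l hl => by
    have hl' : ∀ j, ∀ v ∈ l, s j (-v) = s j v + 1 := fun j v hv => hl v hv j
    simp only [Submodule.mem_bot, LinearMap.sub_apply, LinearMap.add_apply, LinearMap.comp_apply,
      tau_single]
    simp only [al, ga, lift_single, gaL_neg s k l hl']
    cases l with
    | nil => simp [gaL_nil]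
    | cons v l =>
      simp only [hd, List.map_cons, hl' k v (by simp)]
      have : (1 + 1 : ZMod 2) = 0 := rfl
      linear_combination (s k v * gaL s k (v :: l)) * this) hc
  simp only [Submodule.mem_bot, LinearMap.sub_apply, LinearMap.add_apply, LinearMap.comp_apply]
    at this
  rw [map_add]; exact sub_eq_zero.mp this

theorem ga_D (b : List E → E) (hb : ∀ l, b (l.map (fun x => -x)) = - b l) (e : ℕ → E)
    (hb1 : ∀ v, b [v] = v) (m n : ℕ)
    (s : ℕ → E → ZMod 2)
    (hc : ∀ k ≤ n, D b e m k ∈ Finsupp.supported (ZMod 2) (ZMod 2)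
      {l : List E | ∀ v ∈ l, ∀ j, s j (-v) = s j v + 1}) :
    ga s n (D b e m n) = 1 := by
  induction n with
  | zero =>
    have : D b e m 0 = Finsupp.single [e 0] 1 := by
      unfold D
      clear hc
      induction m with
      | zero => rfl
      | succ m ih =>
        rw [Function.iterate_succ_apply', ih]
        simp [sd, bd_cons, hb1]
    rw [this]; simp [ga, gaL]
  | succ k ih =>
    rw [← al_bd, bd_D b hb, al_tau s k (hc k (by omega))]
    exact ih (fun j hj => hc j (by omega))

theorem gaL_ne (s : ℕ → E → ZMod 2) (k : ℕ) (l : List E) (h : gaL s k l ≠ 0) :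
    l ≠ [] ∧ ∀ j < k, ∃ v ∈ l, ∃ w ∈ l, s j v ≠ s j w := by
  induction k generalizing l with
  | zero => rcases l with _ | ⟨v, l⟩ <;> simp_all [gaL]
  | succ k ih =>
    rcases l with _ | ⟨v, _ | ⟨w, l⟩⟩
    · simp [gaL] at h
    · simp [gaL, gaL_nil] at h
    · simp only [gaL, hd] at h
      refine ⟨by simp, fun j hj => ?_⟩
      rcases Nat.lt_succ_iff_lt_or_eq.mp hj with hj | rfl
      · obtain ⟨a, ha, b, hb, hab⟩ := (ih _ (right_ne_zero_of_mul h)).2 j hj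
        exact ⟨a, List.mem_cons_of_mem _ ha, b, List.mem_cons_of_mem _ hb, hab⟩
      · refine ⟨v, by simp, w, by simp, fun hvw => left_ne_zero_of_mul h ?_⟩
        rw [hvw, CharTwo.add_self_eq_zero]

end alg

section geo

theorem cone_supp {E : Type*} {v : E} {Q : Set (List E)} {c : Ch E}
    (hc : c ∈ Finsupp.supported (ZMod 2) (ZMod 2) {l | v :: l ∈ Q}) :
    cone v c ∈ Finsupp.supported (ZMod 2) (ZMod 2) Q := by
  refine supp_map (cone v) _ (fun l hl => ?_) hc
  rw [cone_single]
  exact Finsupp.single_mem_supported _ _ hl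

theorem bd_supp {E : Type*} (l : List E) : bd (Finsupp.single l 1) ∈
    Finsupp.supported (ZMod 2) (ZMod 2) {l' : List E | l'.length + 1 = l.length ∧ l' ⊆ l} := by
  induction l with
  | nil => simp
  | cons v l ih =>
    rw [bd_cons]
    refine Submodule.add_mem _ (Finsupp.single_mem_supported _ _ (by simp)) (cone_supp ?_)
    refine Finsupp.supported_mono ?_ ih
    rintro l' ⟨h1, h2⟩
    refine ⟨by simp [h1], ?_⟩
    exact List.cons_subset_cons v h2

variable {E : Type*} [NormedAddCommGroup E] [NormedSpace ℝ E]

noncomputable def bary (l : List E) : E := (l.length : ℝ)⁻¹ • l.sum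

theorem bary_neg (l : List E) : bary (l.map (fun x => -x)) = - bary l := by
  have : (l.map (fun x => -x)).sum = - l.sum := by
    induction l with
    | nil => simp
    | cons v l ih => simp [ih, add_comm]
  simp [bary, this]

theorem bary_one (v : E) : bary [v] = v := by simp [bary]

theorem bary_mem {A : Set E} (hA : Convex ℝ A) {l : List E} (hl : l ≠ []) (h : ∀ v ∈ l, v ∈ A) :
    bary l ∈ A := by
  have hpos : 0 < l.length := List.length_pos_iff.mpr hl
  have e : bary l = ∑ i : Fin l.length, (l.length : ℝ)⁻¹ • l[i] := by
    rw [← Finset.smul_sum, bary]; congr 1; simp [Fin.sum_univ_getElem]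
  rw [e]
  refine hA.sum_mem (fun i _ => by positivity) ?_ (fun i _ => h _ (by simp))
  have : (l.length : ℝ) ≠ 0 := by positivity
  simp [this]

theorem bary_dist {δ : ℝ} {N : ℕ} {l : List E} (hN : l.length ≤ N)
    (h : ∀ v ∈ l, ∀ w ∈ l, dist v w ≤ δ) {v : E} (hv : v ∈ l) :
    dist v (bary l) ≤ (1 - (N : ℝ)⁻¹) * δ := by
  have hδ : 0 ≤ δ := by simpa using h v hv v hv
  have hpos : 0 < l.length := List.length_pos_of_mem hv
  have hpos' : (0 : ℝ) < l.length := by exact_mod_cast hpos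
  obtain ⟨i0, hi0⟩ := List.get_of_mem hv
  have e : v - bary l = (l.length : ℝ)⁻¹ • ∑ i : Fin l.length, (v - l[i]) := by
    rw [Finset.sum_sub_distrib, smul_sub, bary]
    congr 1
    · simp [← Nat.cast_smul_eq_nsmul ℝ, smul_smul, hpos'.ne']
    · congr 1; simp [Fin.sum_univ_getElem]
  rw [dist_eq_norm, e, norm_smul]
  have h1 : ‖∑ i : Fin l.length, (v - l[i])‖ ≤ (l.length - 1 : ℝ) * δ := by
    rw [← Finset.add_sum_erase _ _ (Finset.mem_univ i0)]
    have : v - l[i0] = 0 := by rw [← hi0]; simp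
    rw [this, zero_add]
    refine (norm_sum_le_of_le (f := fun i : Fin l.length => v - l[i]) (n := fun _ => δ) _ (fun i _ => ?_)).trans ?_
    · rw [← dist_eq_norm]; exact h v hv _ (by simp)
    · simp [Finset.card_erase_of_mem, Nat.cast_sub (Nat.succ_le_of_lt hpos)]
  have h2 : ‖((l.length : ℝ)⁻¹)‖ = (l.length : ℝ)⁻¹ := by
    rw [Real.norm_eq_abs, abs_of_pos (by positivity)]
  rw [h2]
  calc (l.length : ℝ)⁻¹ * _ ≤ (l.length : ℝ)⁻¹ * ((l.length - 1 : ℝ) * δ) := by gcongr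
    _ = (1 - (l.length : ℝ)⁻¹) * δ := by field_simp
    _ ≤ _ := by gcongr

theorem sd_supp {δ : ℝ} (hδ : 0 ≤ δ) {N : ℕ} (hN : 0 < N) (k : ℕ) (hk : k ≤ N) (l : List E)
    (hl : l.length = k) (h : ∀ v ∈ l, ∀ w ∈ l, dist v w ≤ δ) :
    sd bary k (Finsupp.single l 1) ∈ Finsupp.supported (ZMod 2) (ZMod 2)
      {l' : List E | l'.length = k ∧ (∀ v ∈ l', v ∈ convexHull ℝ {x | x ∈ l}) ∧
        ∀ v ∈ l', ∀ w ∈ l', dist v w ≤ (1 - (N : ℝ)⁻¹) * δ} := by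
  induction k generalizing l with
  | zero =>
    obtain rfl : l = [] := List.length_eq_zero_iff.mp hl
    exact Finsupp.single_mem_supported _ _ (by simp)
  | succ k ih =>
    have hne : l ≠ [] := by rintro rfl; simp at hl
    rw [sd_succ_single]
    apply cone_supp
    refine supp_map (sd bary k) _ (fun f hf => ?_) (bd_supp l)
    obtain ⟨hf1, hf2⟩ := hf
    refine Finsupp.supported_mono ?_ (ih (by omega) f (by omega)
      (fun v hv w hw => h v (hf2 hv) w (hf2 hw)))
    rintro l' ⟨h1, h2, h3⟩
    have hb : bary l ∈ convexHull ℝ {x | x ∈ l} :=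
      bary_mem (convex_convexHull ℝ _) hne (fun v hv => subset_convexHull ℝ _ hv)
    have h2' : ∀ v ∈ l', v ∈ convexHull ℝ {x | x ∈ l} := fun v hv =>
      convexHull_mono (fun x hx => hf2 hx) (h2 v hv)
    have hsub : convexHull ℝ {x | x ∈ l} ⊆ Metric.closedBall (bary l) ((1 - (N : ℝ)⁻¹) * δ) :=
      convexHull_min (fun v hv => bary_dist (hl.trans_le hk) h hv) (convex_closedBall _ _)
    have h0 : 0 ≤ (1 - (N : ℝ)⁻¹) * δ := by
      have : (N : ℝ)⁻¹ ≤ 1 := inv_le_one_of_one_le₀ (by exact_mod_cast hN)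
      exact mul_nonneg (by linarith) hδ
    refine ⟨by simp [h1], ?_, ?_⟩
    · intro v hv
      rcases List.mem_cons.mp hv with rfl | hv
      · exact hb
      · exact h2' v hv
    · intro v hv w hw
      rcases List.mem_cons.mp hv with rfl | hv <;> rcases List.mem_cons.mp hw with rfl | hw
      · simpa using h0
      · rw [dist_comm]; exact hsub (h2' w hw)
      · exact hsub (h2' v hv)
      · exact h3 v hv w hw

theorem D_supp {K : Set E} {δ : ℝ} (hδ : 0 ≤ δ) {N : ℕ} (e : ℕ → E) (k : ℕ) (hk : k + 1 ≤ N)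
    (hini : ini e k ∈ Finsupp.supported (ZMod 2) (ZMod 2)
      {l : List E | l.length = k + 1 ∧ (∃ A ⊆ K, Convex ℝ A ∧ ∀ v ∈ l, v ∈ A) ∧
        ∀ v ∈ l, ∀ w ∈ l, dist v w ≤ δ}) (m : ℕ) :
    D bary e m k ∈ Finsupp.supported (ZMod 2) (ZMod 2)
      {l : List E | l.length = k + 1 ∧ (∃ A ⊆ K, Convex ℝ A ∧ ∀ v ∈ l, v ∈ A) ∧
        ∀ v ∈ l, ∀ w ∈ l, dist v w ≤ (1 - (N : ℝ)⁻¹) ^ m * δ} := by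
  have hN : 0 < N := by omega
  have : (N : ℝ)⁻¹ ≤ 1 := inv_le_one_of_one_le₀ (by exact_mod_cast hN)
  unfold D
  induction m with
  | zero => simpa using hini
  | succ m ih =>
    rw [Function.iterate_succ_apply']
    refine supp_map _ _ (fun l hl => ?_) ih
    obtain ⟨h1, ⟨A, hAK, hA, hlA⟩, h3⟩ := hl
    refine Finsupp.supported_mono ?_ (sd_supp (mul_nonneg (pow_nonneg (by linarith) m) hδ) hN
      (k + 1) hk l h1 h3)
    rintro l' ⟨a1, a2, a3⟩
    refine ⟨a1, ⟨A, hAK, hA, fun v hv => convexHull_min hlA hA (a2 v hv)⟩, fun v hv w hw => ?_⟩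
    rw [pow_succ', mul_assoc]
    exact a3 v hv w hw

/-- vertices of the simplices in the initial chain. -/
theorem ini_supp (e : ℕ → E) (k : ℕ) :
    ini e k ∈ Finsupp.supported (ZMod 2) (ZMod 2)
      {l : List E | l.length = k + 1 ∧ ∃ σ : ℕ → ℝ, (∀ j, σ j = 1 ∨ σ j = -1) ∧
        ∀ v ∈ l, ∃ j ≤ k, v = σ j • e j} := by
  induction k with
  | zero =>
    refine Finsupp.single_mem_supported _ _ ⟨by simp, fun _ => 1, by simp, ?_⟩
    intro v hv
    exact ⟨0, le_rfl, by simpa using hv⟩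
  | succ k ih =>
    rw [ini]
    have key : ∀ l : List E, (l.length = k + 1 ∧ ∃ σ : ℕ → ℝ, (∀ j, σ j = 1 ∨ σ j = -1) ∧
        ∀ v ∈ l, ∃ j ≤ k, v = σ j • e j) → e (k + 1) :: l ∈ 
        {l : List E | l.length = k + 1 + 1 ∧ ∃ σ : ℕ → ℝ, (∀ j, σ j = 1 ∨ σ j = -1) ∧
        ∀ v ∈ l, ∃ j ≤ k + 1, v = σ j • e j} := by
      rintro l ⟨h1, σ, hσ, h2⟩
      refine ⟨by simp [h1], fun j => if j = k + 1 then 1 else σ j, ?_, ?_⟩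
      · intro j; by_cases hj : j = k + 1 <;> simp [hj, hσ]
      · intro v hv
        rcases List.mem_cons.mp hv with rfl | hv
        · exact ⟨k + 1, le_rfl, by simp⟩
        · obtain ⟨j, hj, rfl⟩ := h2 v hv
          exact ⟨j, by omega, by
            have hjk : j ≠ k + 1 := by omega
            simp [hjk]⟩
    apply cone_supp
    refine Submodule.add_mem _ (Finsupp.supported_mono key ih) ?_
    refine supp_map tau _ (fun l hl => ?_) ih
    rw [tau_single]
    refine Finsupp.single_mem_supported _ _ (key _ ?_)
    obtain ⟨h1, σ, hσ, h2⟩ := hl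
    refine ⟨by simp [h1], fun j => - σ j, fun j => ?_, ?_⟩
    · rcases hσ j with h | h <;> simp [h]
    · intro v hv
      obtain ⟨u, hu, rfl⟩ := List.mem_map.mp hv
      obtain ⟨j, hj, rfl⟩ := h2 u hu
      exact ⟨j, hj, by simp⟩

end geo

section final

abbrev V (n : ℕ) := EuclideanSpace ℝ (Fin n)

def KK (n : ℕ) : Set (V (n + 1)) := {x | ∑ i, |x i| = 1}

noncomputable def ee (n : ℕ) (j : ℕ) : V (n + 1) :=
  if h : j < n + 1 then EuclideanSpace.single ⟨j, h⟩ 1 else 0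

theorem KK_compact (n : ℕ) : IsCompact (KK n) := by
  refine Metric.isCompact_of_isClosed_isBounded ?_ ?_
  · exact isClosed_eq (by fun_prop) continuous_const
  · refine (Metric.isBounded_iff_subset_closedBall 0).mpr ⟨1, fun x hx => ?_⟩
    have hx' : ∑ i, |x i| = 1 := hx
    rw [mem_closedBall_zero_iff, EuclideanSpace.norm_eq, Real.sqrt_le_one]
    calc ∑ i, ‖x i‖ ^ 2 ≤ (∑ i, ‖x i‖) ^ 2 :=
          Finset.sum_sq_le_sq_sum_of_nonneg (fun i _ => norm_nonneg _)
      _ = 1 := by simp [hx']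

theorem KK_ne (n : ℕ) {x : V (n + 1)} (hx : x ∈ KK n) : x ≠ 0 := by
  rintro rfl
  simp [KK] at hx

theorem ini_geo (n k : ℕ) (hk : k ≤ n) : ini (ee n) k ∈ Finsupp.supported (ZMod 2) (ZMod 2)
      {l : List (V (n + 1)) | l.length = k + 1 ∧ (∃ A ⊆ KK n, Convex ℝ A ∧ ∀ v ∈ l, v ∈ A) ∧
        ∀ v ∈ l, ∀ w ∈ l, dist v w ≤ 2} := by
  refine Finsupp.supported_mono ?_ (ini_supp (ee n) k)
  rintro l ⟨h1, σ, hσ, h2⟩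
  refine ⟨h1, ⟨{x | (∀ i : Fin (n + 1), 0 ≤ σ i * x i) ∧ ∑ i : Fin (n + 1), σ i * x i = 1}, ?_, ?_, ?_⟩, ?_⟩
  · rintro x ⟨hx1, hx2⟩
    change ∑ i, |x i| = 1
    rw [← hx2]
    refine Finset.sum_congr rfl fun i _ => ?_
    rw [← abs_of_nonneg (hx1 i), abs_mul]
    rcases hσ i with h | h <;> simp [h]
  · rintro x ⟨hx1, hx2⟩ y ⟨hy1, hy2⟩ a b ha hb hab
    refine ⟨fun i => ?_, ?_⟩
    · have := mul_nonneg ha (hx1 i)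
      have := mul_nonneg hb (hy1 i)
      simp only [PiLp.add_apply, PiLp.smul_apply, smul_eq_mul]
      nlinarith
    · have : ∑ i : Fin (n + 1), σ i * (a • x + b • y) i =
          a * ∑ i : Fin (n + 1), σ i * x i + b * ∑ i : Fin (n + 1), σ i * y i := by
        rw [Finset.mul_sum, Finset.mul_sum, ← Finset.sum_add_distrib]
        refine Finset.sum_congr rfl fun i _ => ?_
        simp only [PiLp.add_apply, PiLp.smul_apply, smul_eq_mul]
        ring
      rw [this, hx2, hy2]; simpa using hab
  · intro v hv
    obtain ⟨j, hj, rfl⟩ := h2 v hv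
    have hj' : j < n + 1 := by omega
    have hss : σ j * σ j = 1 := by rcases hσ j with h | h <;> simp [h]
    have hval : ∀ i : Fin (n + 1), σ i * (σ j • ee n j) i = if i = ⟨j, hj'⟩ then 1 else 0 := by
      intro i
      by_cases hi : i = ⟨j, hj'⟩
      · subst hi; simp [ee, hj', hss]
      · simp [ee, hj', hi]
    refine ⟨fun i => ?_, ?_⟩
    · rw [hval]; split_ifs <;> norm_num
    · rw [Finset.sum_congr rfl (fun i _ => hval i)]; simp
  · have hn : ∀ v ∈ l, ‖v‖ ≤ 1 := by
      intro v hv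
      obtain ⟨j, hj, rfl⟩ := h2 v hv
      have hj' : j < n + 1 := by omega
      rw [norm_smul]
      rcases hσ j with h | h <;> simp [h, ee, hj']
    intro v hv w hw
    rw [dist_eq_norm]
    linarith [norm_sub_le v w, hn v hv, hn w hw]

theorem exists_chi (n : ℕ) : ∃ χ : V n → ZMod 2, ∀ v ≠ 0, χ (-v) = χ v + 1 := by
  classical
  refine ⟨fun v => if v = (Quot.out (s(v, -v) : Sym2 (V n))).1 then 1 else 0, fun v hv => ?_⟩
  have hne : -v ≠ v := fun h => hv (by
    have h2 : (2 : ℝ) • v = 0 := by rw [two_smul]; nth_rewrite 1 [← h]; simp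
    simpa using h2)
  have hs : (s(-v, - -v) : Sym2 (V n)) = s(v, -v) := by rw [neg_neg, Sym2.eq_swap]
  simp only [hs]
  have hmem : (Quot.out (s(v, -v) : Sym2 (V n))).1 ∈ (s(v, -v) : Sym2 (V n)) :=
    Sym2.out_fst_mem _
  rcases Sym2.mem_iff.mp hmem with h | h
  · rw [h, if_neg hne, if_pos rfl]; rfl
  · rw [h, if_neg hne.symm, if_pos rfl]; rfl

/-- Core: an odd continuous family on the ℓ¹ sphere has a zero. -/
theorem core (n : ℕ) (F : V (n + 1) → (Fin n → ℝ)) (hF : ContinuousOn F (KK n))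
    (hodd : ∀ x, F (-x) = - F x) : ∃ x ∈ KK n, F x = 0 := by
  by_contra! hno
  obtain ⟨χ, hχ⟩ := exists_chi (n + 1)
  have hK := KK_compact n
  -- lower bound
  have hKne : (KK n).Nonempty := ⟨EuclideanSpace.single 0 1, by
    change ∑ i, |(EuclideanSpace.single (0 : Fin (n + 1)) (1 : ℝ) : V (n + 1)) i| = 1
    rw [Finset.sum_eq_single 0] <;> simp +contextual⟩
  obtain ⟨x0, hx0, hmin⟩ := hK.exists_isMinOn hKne hF.norm
  have hε : 0 < ‖F x0‖ := norm_pos_iff.mpr (hno x0 hx0)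
  set ε := ‖F x0‖ with hεd
  have huc := hK.uniformContinuousOn_of_continuous hF
  obtain ⟨δ, hδ, hd⟩ := Metric.uniformContinuousOn_iff.mp huc (ε / 2) (by positivity)
  -- mesh
  have hρ : ((n + 1 : ℕ) : ℝ)⁻¹ ≤ 1 := inv_le_one_of_one_le₀ (by simp)
  have hρ' : 0 < ((n + 1 : ℕ) : ℝ)⁻¹ := by positivity
  obtain ⟨m, hm⟩ := exists_pow_lt_of_lt_one (show 0 < δ / 2 by positivity)
    (show 1 - ((n + 1 : ℕ) : ℝ)⁻¹ < 1 by linarith)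
  have hD : ∀ k ≤ n, _ := fun k hk =>
    D_supp (by norm_num : (0 : ℝ) ≤ 2) (N := n + 1) (ee n) k (by omega) (ini_geo n k hk) m
  -- the sign functions
  let G : ℕ → V (n + 1) → ℝ := fun j x => if h : j < n then F x ⟨j, h⟩ else 0
  have hG : ∀ j x, G j (-x) = - G j x := by
    intro j x
    by_cases h : j < n <;> simp [G, h, hodd]
  let s : ℕ → V (n + 1) → ZMod 2 := fun j x =>
    if 0 < G j x then 1 else if G j x < 0 then 0 else χ x
  have hs : ∀ j, ∀ v ≠ 0, s j (-v) = s j v + 1 := by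
    intro j v hv
    simp only [s, hG]
    rcases lt_trichotomy (G j v) 0 with h | h | h
    · simp [h, h.not_gt]
    · simp [h, hχ v hv]
    · simp [h, h.not_gt]; rfl
  have h1 := ga_D bary bary_neg (ee n) bary_one m n s (fun k hk => by
    refine Finsupp.supported_mono ?_ (hD k hk)
    rintro l ⟨-, ⟨A, hAK, -, hlA⟩, -⟩ v hv j
    exact hs j v (KK_ne n (hAK (hlA v hv))))
  have h2 : ∃ l ∈ (D bary (ee n) m n).support, gaL s n l ≠ 0 := by
    by_contra! hcon
    have : ga s n (D bary (ee n) m n) = 0 := by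
      simp only [ga, lift, Finsupp.linearCombination_apply, Finsupp.sum]
      exact Finset.sum_eq_zero fun l hl => by rw [hcon l hl, smul_zero]
    rw [this] at h1; exact zero_ne_one h1
  obtain ⟨l, hl, hne⟩ := h2
  obtain ⟨-, ⟨A, hAK, -, hlA⟩, hmesh⟩ := (Finsupp.mem_supported _ _).mp (hD n le_rfl) hl
  obtain ⟨hl0, hch⟩ := gaL_ne s n l hne
  obtain ⟨u, hu⟩ := List.exists_mem_of_ne_nil l hl0
  have hclose : ∀ v ∈ l, ∀ w ∈ l, ∀ j, |F v j - F w j| < ε / 2 := by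
    intro v hv w hw j
    have := hd v (hAK (hlA v hv)) w (hAK (hlA w hw))
      ((hmesh v hv w hw).trans_lt (by linarith))
    have h3 := dist_le_pi_dist (F v) (F w) j
    rw [Real.dist_eq] at h3
    linarith
  have hlt : ‖F u‖ < ε := by
    rw [pi_norm_lt_iff hε]
    intro j
    obtain ⟨v, hv, w, hw, hvw⟩ := hch j j.2
    have hGF : ∀ x, G j x = F x j := fun x => by simp [G]
    have a1 := abs_lt.mp (hclose v hv w hw j)
    have a2 := abs_lt.mp (hclose u hu v hv j)
    have a3 := abs_lt.mp (hclose u hu w hw j)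
    have : (F v j ≤ 0 ∧ 0 ≤ F w j) ∨ (F w j ≤ 0 ∧ 0 ≤ F v j) := by
      by_contra! hcon
      apply hvw
      simp only [s, hGF]
      rcases lt_trichotomy (F v j) 0 with h | h | h
      · have := hcon.1 h.le
        simp [h, h.not_gt, this, this.not_gt]
      · have := hcon.1 h.le
        have := hcon.2 this.le
        linarith
      · have : 0 < F w j := by
          by_contra! h'
          linarith [hcon.2 h']
        simp [h, this]
    rw [Real.norm_eq_abs, abs_lt]
    rcases this with h | h <;> constructor <;> linarith [h.1, h.2]
  exact absurd (hmin (hAK (hlA u hu))) (by simpa using hlt)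

end final
end BU

theorem stmt4 (n : ℕ) (g : EuclideanSpace ℝ (Fin (n + 1)) → EuclideanSpace ℝ (Fin n))
    (hg : ContinuousOn g (Metric.sphere 0 1)) :
    ∃ x ∈ Metric.sphere (0 : EuclideanSpace ℝ (Fin (n + 1))) 1, g (-x) = g x := by
  have hr : ∀ x ∈ BU.KK n, ‖x‖⁻¹ • x ∈ Metric.sphere (0 : EuclideanSpace ℝ (Fin (n + 1))) 1 := by
    intro x hx
    have := norm_ne_zero_iff.mpr (BU.KK_ne n hx)
    simp [norm_smul, this]
  have hrc : ContinuousOn (fun x : EuclideanSpace ℝ (Fin (n + 1)) => ‖x‖⁻¹ • x) (BU.KK n) :=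
    (continuousOn_id.norm.inv₀ fun x hx => norm_ne_zero_iff.mpr (BU.KK_ne n hx)).smul
      continuousOn_id
  have c1 := hg.comp hrc hr
  have c2 := hg.comp hrc.neg (fun x hx => by simpa using hr x hx)
  obtain ⟨x, hx, h⟩ := BU.core n (fun x => WithLp.ofLp (g (‖x‖⁻¹ • x) - g (-(‖x‖⁻¹ • x))))
    ((PiLp.continuous_ofLp 2 _).comp_continuousOn (c1.sub c2))
    (fun x => by simp)
  refine ⟨_, hr x hx, ?_⟩
  have h' : g (‖x‖⁻¹ • x) - g (-(‖x‖⁻¹ • x)) = 0 := (WithLp.ofLp_eq_zero 2).mp h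
  exact (sub_eq_zero.mp h').symm
end

section
/- Let U₁,…,U_{n+1} be open sets covering S^n. Then there exists an index i and a point x ∈ S^n with x ∈ U_i and -x ∈ U_i. -/
namespace LS

/-- Coboundary (mod 2) of a cochain on finite sequences of points. -/
def cob {E : Type*} : (List E → ZMod 2) → List E → ZMod 2
  | _, [] => 0
  | φ, x :: l => φ l + cob (fun m => φ (x :: m)) l

/-- Dual prism operator between the maps `f` and `g`. -/
def prism {E : Type*} (f g : E → E) : (List E → ZMod 2) → List E → ZMod 2
  | _, [] => 0
  | φ, x :: l => φ (f x :: g x :: l.map g) + prism f g (fun m => φ (f x :: m)) l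

/-- Cup product of the coboundaries of the given 0-cochains. -/
def cup {E : Type*} : List (E → ZMod 2) → List E → ZMod 2
  | [], [_] => 1
  | s :: ss, x :: y :: l => (s x + s y) * cup ss (y :: l)
  | _, _ => 0

/-- A 0-cochain times the cup product. -/
def hcup {E : Type*} (s : E → ZMod 2) (ss : List (E → ZMod 2)) : List E → ZMod 2
  | [] => 0
  | x :: l => s x * cup ss (x :: l)

lemma two (a : ZMod 2) : a + a = 0 := CharTwo.add_self_eq_zero a

section
variable {E : Type*}

lemma cob_add (φ ψ : List E → ZMod 2) (l : List E) :
    cob (fun m => φ m + ψ m) l = cob φ l + cob ψ l := by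
  induction l generalizing φ ψ with
  | nil => simp [cob]
  | cons x l ih => simp only [cob, ih]; ring

lemma cob_mul (a : ZMod 2) (φ : List E → ZMod 2) (l : List E) :
    cob (fun m => a * φ m) l = a * cob φ l := by
  induction l generalizing φ with
  | nil => simp [cob]
  | cons x l ih => simp only [cob, ih]; ring

lemma cob_cob (φ : List E → ZMod 2) (l : List E) : cob (cob φ) l = 0 := by
  induction l generalizing φ with
  | nil => simp [cob]
  | cons x l ih =>
    simp only [cob, cob_add, ih, add_zero]
    exact two _

lemma cob_map (f : E → E) (φ : List E → ZMod 2) (l : List E) :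
    cob (fun m => φ (m.map f)) l = cob φ (l.map f) := by
  induction l generalizing φ with
  | nil => simp [cob]
  | cons x l ih =>
    simp only [cob, List.map_cons]
    rw [ih (fun m => φ (f x :: m))]

lemma prism_add (f g : E → E) (φ ψ : List E → ZMod 2) (l : List E) :
    prism f g (fun m => φ m + ψ m) l = prism f g φ l + prism f g ψ l := by
  induction l generalizing φ ψ with
  | nil => simp [prism]
  | cons x l ih => simp only [prism, ih]; ring

lemma prism_cob (f g : E → E) (φ : List E → ZMod 2) (l : List E) :
    prism f g (cob φ) l = cob (prism f g φ) l + (φ (l.map f) + φ (l.map g)) := by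
  induction l generalizing φ with
  | nil => simp [prism, cob, two]
  | cons x l ih =>
    simp only [prism, cob, prism_add, cob_add, ih, List.map_cons]
    rw [cob_map g (fun m => φ (f x :: g x :: m))]
    linear_combination two (φ (f x :: List.map g l))

lemma prism_congr (f g : E → E) (φ ψ : List E → ZMod 2) (l : List E)
    (h : ∀ m, (∀ y ∈ m, ∃ x ∈ l, y = f x ∨ y = g x) → φ m = ψ m) :
    prism f g φ l = prism f g ψ l := by
  induction l generalizing φ ψ with
  | nil => simp [prism]
  | cons x l ih =>
    simp only [prism]
    congr 1
    · apply h
      intro y hy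
      simp only [List.mem_cons, List.mem_map] at hy
      rcases hy with rfl | rfl | ⟨z, hz, rfl⟩
      · exact ⟨x, by simp⟩
      · exact ⟨x, by simp⟩
      · exact ⟨z, by simp [hz]⟩
    · apply ih
      intro m hm
      apply h
      intro y hy
      rcases List.mem_cons.1 hy with rfl | hy
      · exact ⟨x, by simp⟩
      · obtain ⟨z, hz, h'⟩ := hm y hy
        exact ⟨z, by simp [hz], h'⟩

lemma cob_hcup_aux (s : E → ZMod 2) (ss : List (E → ZMod 2))
    (h : ∀ l, cob (cup ss) l = 0) (l : List E) : cob (hcup s ss) l = cup (s :: ss) l := by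
  match l with
  | [] => simp [cob, cup]
  | [x] => simp [cob, cup, hcup]
  | x :: y :: l =>
    have h1 := h (x :: y :: l)
    rw [cob] at h1
    rw [cob]
    simp only [hcup, cup]
    rw [cob_mul]
    linear_combination s x * h1 - two (s x * cup ss (y :: l))

lemma cob_cup (ss : List (E → ZMod 2)) (l : List E) : cob (cup ss) l = 0 := by
  induction ss generalizing l with
  | nil =>
    match l with
    | [] => simp [cob]
    | [x] => simp [cob, cup]
    | [x, y] => simp [cob, cup, two]
    | x :: y :: z :: l =>
      have : ∀ (l : List E) (φ : List E → ZMod 2), (∀ m, φ m = 0) → cob φ l = 0 := by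
        intro l
        induction l with
        | nil => intros; simp [cob]
        | cons x l ih => intro φ h; rw [cob, h, zero_add]; exact ih _ (fun m => h _)
      simp only [cob, cup, zero_add]
      exact this _ _ (fun m => rfl)
  | cons s ss ih =>
    have : cup (s :: ss) = cob (hcup s ss) := by
      funext l; exact (cob_hcup_aux s ss ih l).symm
    rw [this, cob_cob]

lemma cob_hcup (s : E → ZMod 2) (ss : List (E → ZMod 2)) :
    cob (hcup s ss) = cup (s :: ss) := by
  funext l; exact cob_hcup_aux s ss (cob_cup ss) l

lemma cup_zero (ss : List (E → ZMod 2)) (l : List E)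
    (h : ∃ s ∈ ss, ∀ x ∈ l, ∀ y ∈ l, s x = s y) : cup ss l = 0 := by
  induction ss generalizing l with
  | nil => simp at h
  | cons t ss ih =>
    match l with
    | [] => rfl
    | [x] => rfl
    | x :: y :: l =>
      simp only [cup]
      obtain ⟨s, hs, h⟩ := h
      rcases List.mem_cons.1 hs with rfl | hs
      · rw [h x (by simp) y (by simp), two, zero_mul]
      · rw [ih (y :: l) ⟨s, hs, fun a ha b hb =>
          h a (List.mem_cons_of_mem _ ha) b (List.mem_cons_of_mem _ hb)⟩, mul_zero]

lemma cup_neg [Neg E] (ss : List (E → ZMod 2)) (l : List E)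
    (h : ∀ s ∈ ss, ∀ x ∈ l, s (-x) = s x + 1) : cup ss (l.map (fun x => -x)) = cup ss l := by
  induction ss generalizing l with
  | nil =>
    match l with
    | [] => rfl
    | [x] => rfl
    | x :: y :: l => rfl
  | cons t ss ih =>
    match l with
    | [] => rfl
    | [x] => rfl
    | x :: y :: l =>
      have := ih (y :: l) (fun s hs x hx =>
        h s (List.mem_cons_of_mem _ hs) x (List.mem_cons_of_mem _ hx))
      simp only [List.map_cons] at this
      simp only [List.map_cons, cup, this]
      rw [h t (by simp) x (by simp), h t (by simp) y (by simp)]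
      linear_combination two (cup ss (y :: l))

end

/-- Euclidean space. -/
abbrev Eu (n : ℕ) := EuclideanSpace ℝ (Fin (n + 1))

/-- The coordinate vectors (zero beyond the dimension). -/
noncomputable def bv (n k : ℕ) : Eu n := WithLp.toLp 2 (fun i => if (i : ℕ) = k then 1 else 0)

/-- Rotation of a point of the equator towards the pole `bv n k`. -/
noncomputable def rot (n N k j : ℕ) (x : Eu n) : Eu n :=
  Real.cos (j / N * (Real.pi / 2)) • x + Real.sin (j / N * (Real.pi / 2)) • bv n k

/-- Evaluation of cochains on the hemisphere chain of dimension `k`. -/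
noncomputable def hemi (n N : ℕ) : ℕ → (List (Eu n) → ZMod 2) → ZMod 2
  | 0, φ => φ [bv n 0]
  | k + 1, φ => ∑ j ∈ Finset.range N,
      (hemi n N k (prism (rot n N (k + 1) j) (rot n N (k + 1) (j + 1)) φ)
        + hemi n N k (fun l => prism (rot n N (k + 1) j) (rot n N (k + 1) (j + 1)) φ
            (l.map (fun x => -x))))

/-- The small simplices in dimension `k`. -/
def Good (n N k : ℕ) (l : List (Eu n)) : Prop :=
  (∀ x ∈ l, ‖x‖ = 1 ∧ ∀ i : Fin (n + 1), k < (i : ℕ) → x i = 0) ∧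
  ∀ x ∈ l, ∀ y ∈ l, ‖x - y‖ ≤ k * (Real.pi / N)

lemma hemi_add (n N k : ℕ) (φ ψ : List (Eu n) → ZMod 2) :
    hemi n N k (fun l => φ l + ψ l) = hemi n N k φ + hemi n N k ψ := by
  induction k generalizing φ ψ with
  | zero => simp [hemi]
  | succ k ih =>
    simp only [hemi]
    rw [← Finset.sum_add_distrib]
    refine Finset.sum_congr rfl fun j _ => ?_
    have : prism (rot n N (k + 1) j) (rot n N (k + 1) (j + 1)) (fun l => φ l + ψ l)
      = fun l => prism (rot n N (k + 1) j) (rot n N (k + 1) (j + 1)) φ l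
        + prism (rot n N (k + 1) j) (rot n N (k + 1) (j + 1)) ψ l := by
      funext l; exact prism_add _ _ _ _ _
    simp only [this, ih]
    ring

lemma norm_bv (n k : ℕ) (hk : k ≤ n) : ‖bv n k‖ = 1 := by
  have : bv n k = EuclideanSpace.single (⟨k, by omega⟩ : Fin (n + 1)) (1 : ℝ) := by
    ext i
    simp [bv, Fin.ext_iff, Pi.single_apply]
  rw [this]; simp

lemma inner_bv (n k : ℕ) (x : Eu n) (hx : ∀ i : Fin (n + 1), k < (i : ℕ) → x i = 0) :
    inner ℝ x (bv n (k + 1)) = 0 := by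
  rw [PiLp.inner_apply]
  refine Finset.sum_eq_zero fun i _ => ?_
  by_cases h : (i : ℕ) = k + 1
  · rw [hx i (by omega)]; simp
  · simp [bv, h]

lemma norm_rot (n N k j : ℕ) (hk : k + 1 ≤ n) (x : Eu n) (h1 : ‖x‖ = 1)
    (hx : ∀ i : Fin (n + 1), k < (i : ℕ) → x i = 0) : ‖rot n N (k + 1) j x‖ = 1 := by
  have h2 : ‖rot n N (k + 1) j x‖ ^ 2 = 1 := by
    rw [rot, norm_add_sq_real, norm_smul, norm_smul, h1, norm_bv n _ hk, inner_smul_left,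
      inner_smul_right, inner_bv n k x hx]
    simp
  nlinarith [norm_nonneg (rot n N (k + 1) j x)]

lemma rot_dist (n N k i j : ℕ) (hk : k + 1 ≤ n) (hij : |(i : ℝ) - j| ≤ 1) (x y : Eu n)
    (hy : ‖y‖ = 1) :
    ‖rot n N (k + 1) i x - rot n N (k + 1) j y‖ ≤ ‖x - y‖ + Real.pi / N := by
  set a := (i : ℝ) / N * (Real.pi / 2) with ha
  set b := (j : ℝ) / N * (Real.pi / 2) with hb
  have hab : |a - b| ≤ Real.pi / N / 2 := by
    have : a - b = ((i : ℝ) - j) * (Real.pi / N / 2) := by rw [ha, hb]; ring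
    rw [this, abs_mul]
    have hp : 0 ≤ Real.pi / N / 2 := by positivity
    rw [abs_of_nonneg hp]
    nlinarith
  have hc : |Real.cos a - Real.cos b| ≤ |a - b| := Real.abs_cos_sub_cos_le a b
  have hs : |Real.sin a - Real.sin b| ≤ |a - b| := Real.abs_sin_sub_sin_le a b
  have e : rot n N (k + 1) i x - rot n N (k + 1) j y
      = Real.cos a • (x - y) + (Real.cos a - Real.cos b) • y
        + (Real.sin a - Real.sin b) • bv n (k + 1) := by
    simp only [rot, ← ha, ← hb]
    module
  rw [e]
  refine (norm_add₃_le).trans ?_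
  rw [norm_smul, norm_smul, norm_smul, hy, norm_bv n _ hk]
  simp only [Real.norm_eq_abs]
  have := Real.abs_cos_le_one a
  nlinarith [norm_nonneg (x - y)]

lemma good_neg (n N k : ℕ) (l : List (Eu n)) (h : Good n N k l) :
    Good n N k (l.map (fun x => -x)) := by
  constructor
  · intro x hx
    obtain ⟨y, hy, rfl⟩ := List.mem_map.1 hx
    refine ⟨by simpa using (h.1 y hy).1, fun i hi => ?_⟩
    simp [(h.1 y hy).2 i hi]
  · intro x hx y hy
    obtain ⟨a, ha, rfl⟩ := List.mem_map.1 hx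
    obtain ⟨b, hb, rfl⟩ := List.mem_map.1 hy
    rw [neg_sub_neg, norm_sub_rev]
    exact h.2 a ha b hb

lemma good_rot (n N k j : ℕ) (hk : k + 1 ≤ n) (l m : List (Eu n)) (h : Good n N k l)
    (hm : ∀ y ∈ m, ∃ x ∈ l, y = rot n N (k + 1) j x ∨ y = rot n N (k + 1) (j + 1) x) :
    Good n N (k + 1) m := by
  have hm' : ∀ y ∈ m, ∃ x ∈ l, ∃ i : ℕ, (i = j ∨ i = j + 1) ∧ y = rot n N (k + 1) i x := by
    intro y hy
    obtain ⟨x, hx, h | h⟩ := hm y hy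
    · exact ⟨x, hx, j, by simp, h⟩
    · exact ⟨x, hx, j + 1, by simp, h⟩
  constructor
  · intro y hy
    obtain ⟨x, hx, i, -, rfl⟩ := hm' y hy
    refine ⟨norm_rot n N k i hk x (h.1 x hx).1 (h.1 x hx).2, fun a ha => ?_⟩
    have h1 : x a = 0 := (h.1 x hx).2 a (by omega)
    have h2 : (a : ℕ) ≠ k + 1 := by omega
    simp [rot, bv, h1, h2]
  · intro y hy y' hy'
    obtain ⟨x, hx, i, hi, rfl⟩ := hm' y hy
    obtain ⟨x', hx', i', hi', rfl⟩ := hm' y' hy'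
    have h1 : |(i : ℝ) - i'| ≤ 1 := by
      rcases hi with rfl | rfl <;> rcases hi' with rfl | rfl <;> simp
    have := rot_dist n N k i i' hk h1 x x' (h.1 x' hx').1
    have := h.2 x hx x' hx'
    push_cast
    linarith

lemma hemi_congr (n N k : ℕ) (hk : k ≤ n) (φ ψ : List (Eu n) → ZMod 2)
    (h : ∀ l, Good n N k l → φ l = ψ l) : hemi n N k φ = hemi n N k ψ := by
  induction k generalizing φ ψ with
  | zero =>
    simp only [hemi]
    apply h
    constructor
    · intro x hx
      rw [List.mem_singleton] at hx
      subst hx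
      refine ⟨norm_bv n 0 hk, fun i hi => ?_⟩
      have : (i : ℕ) ≠ 0 := by omega
      simp only [bv, this, if_false]
    · simp
  | succ k ih =>
    simp only [hemi]
    refine Finset.sum_congr rfl fun j _ => ?_
    congr 1
    · refine ih (by omega) _ _ fun l hl => prism_congr _ _ _ _ _ fun m hm => ?_
      exact h _ (good_rot n N k j hk l m hl hm)
    · refine ih (by omega) _ _ fun l hl => prism_congr _ _ _ _ _ fun m hm => ?_
      exact h _ (good_rot n N k j hk _ m (good_neg n N k l hl) hm)

/-- The antipodally symmetric sphere chain. -/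
noncomputable def sph (n N k : ℕ) (φ : List (Eu n) → ZMod 2) : ZMod 2 :=
  hemi n N k φ + hemi n N k (fun l => φ (l.map (fun x => -x)))

lemma sph_add (n N k : ℕ) (φ ψ : List (Eu n) → ZMod 2) :
    sph n N k (fun l => φ l + ψ l) = sph n N k φ + sph n N k ψ := by
  simp only [sph, hemi_add]; ring

lemma sph_neg (n N k : ℕ) (φ : List (Eu n) → ZMod 2) :
    sph n N k (fun l => φ (l.map (fun x => -x))) = sph n N k φ := by
  simp only [sph, List.map_map]
  have : ((fun x : Eu n => -x) ∘ fun x => -x) = id := by funext x; simp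
  simp only [this, List.map_id]
  ring

lemma hemi_cob_of (n N k : ℕ) (hN : 0 < N)
    (hz : ∀ φ, sph n N k (cob φ) = 0) (φ : List (Eu n) → ZMod 2) :
    hemi n N (k + 1) (cob φ) = sph n N k φ := by
  have h1 : ∀ j, sph n N k (prism (rot n N (k + 1) j) (rot n N (k + 1) (j + 1)) (cob φ))
      = sph n N k (fun l => φ (l.map (rot n N (k + 1) (j + 1))))
        - sph n N k (fun l => φ (l.map (rot n N (k + 1) j))) := by
    intro j
    have : prism (rot n N (k + 1) j) (rot n N (k + 1) (j + 1)) (cob φ)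
      = fun l => cob (prism (rot n N (k + 1) j) (rot n N (k + 1) (j + 1)) φ) l
        + (φ (l.map (rot n N (k + 1) j)) + φ (l.map (rot n N (k + 1) (j + 1)))) := by
      funext l; exact prism_cob _ _ _ _
    rw [this, sph_add, hz, zero_add, sph_add]
    linear_combination two (sph n N k (fun l => φ (l.map (rot n N (k + 1) j))))
  have h2 : hemi n N (k + 1) (cob φ) = ∑ j ∈ Finset.range N,
      sph n N k (prism (rot n N (k + 1) j) (rot n N (k + 1) (j + 1)) (cob φ)) := rfl
  rw [h2, Finset.sum_congr rfl (fun j _ => h1 j),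
    Finset.sum_range_sub (fun j => sph n N k (fun l => φ (l.map (rot n N (k + 1) j))))]
  have h3 : rot n N (k + 1) 0 = id := by funext x; simp [rot]
  have hN' : (N : ℝ) ≠ 0 := by positivity
  have h4 : rot n N (k + 1) N = fun _ => bv n (k + 1) := by
    funext x; simp [rot, div_self hN']
  have h5 : sph n N k (fun l => φ (l.map (rot n N (k + 1) N))) = 0 := by
    rw [h4]
    simp only [sph, List.map_map]
    exact two _
  rw [h5, h3]
  simp only [List.map_id]
  linear_combination - two (sph n N k φ)

lemma sph_cob (n N k : ℕ) (hN : 0 < N) (φ : List (Eu n) → ZMod 2) :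
    sph n N k (cob φ) = 0 := by
  induction k generalizing φ with
  | zero => simp [sph, hemi, cob, two]
  | succ k ih =>
    rw [sph]
    have : (fun l => cob φ (l.map (fun x => -x))) = cob (fun l => φ (l.map (fun x => -x))) := by
      funext l; exact (cob_map _ _ _).symm
    rw [this, hemi_cob_of n N k hN ih, hemi_cob_of n N k hN ih, sph_neg, two]

lemma hemi_cup (n N : ℕ) (hN : 0 < N) (ss : List (Eu n → ZMod 2)) (hk : ss.length ≤ n)
    (h : ∀ s ∈ ss, ∀ x : Eu n, ‖x‖ = 1 → s (-x) = s x + 1) :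
    hemi n N ss.length (cup ss) = 1 := by
  induction ss with
  | nil => simp [hemi, cup]
  | cons s ss ih =>
    rw [List.length_cons] at hk ⊢
    rw [← cob_hcup, hemi_cob_of n N _ hN (sph_cob n N _ hN), sph, ← hemi_add,
      ← ih (by omega) (fun t ht => h t (List.mem_cons_of_mem _ ht))]
    refine hemi_congr n N _ (by omega) _ _ fun l hl => ?_
    match l with
    | [] => cases ss <;> simp [hcup, cup]
    | x :: l =>
      have h1 := cup_neg ss (x :: l) (fun t ht y hy =>
        h t (List.mem_cons_of_mem _ ht) y (hl.1 y hy).1)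
      simp only [List.map_cons] at h1
      simp only [List.map_cons, hcup, h1]
      rw [h s (by simp) x (hl.1 x (by simp)).1]
      linear_combination two (s x * cup ss (x :: l))

/-- An arbitrary antisymmetric choice of sign. -/
lemma exists_sign (n : ℕ) : ∃ σ : Eu n → ZMod 2, ∀ x : Eu n, ‖x‖ = 1 → σ (-x) = σ x + 1 := by
  classical
  refine ⟨fun x => if WellOrderingRel x (-x) then 1 else 0, fun x hx => ?_⟩
  have hne : x ≠ -x := by
    intro h
    have : x = 0 := by
      ext i
      have h2 : x i = -x i := congrArg (fun v : Eu n => v i) h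
      have h3 : x i = 0 := by linarith
      simpa using h3
    simp [this] at hx
  simp only [neg_neg]
  rcases trichotomous_of WellOrderingRel x (-x) with h | h | h
  · have h' : ¬ WellOrderingRel (-x) x := asymm h
    simp [h, h', two]
  · exact absurd h hne
  · have h' : ¬ WellOrderingRel x (-x) := asymm h
    simp [h, h']

end LS

open LS in
theorem stmt12 (n : ℕ) (U : Fin (n + 1) → Set (EuclideanSpace ℝ (Fin (n + 1))))
    (hU : ∀ i, IsOpen (U i))
    (hcover : Metric.sphere (0 : EuclideanSpace ℝ (Fin (n + 1))) 1 ⊆ ⋃ i, U i) :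
    ∃ i, ∃ x ∈ Metric.sphere (0 : EuclideanSpace ℝ (Fin (n + 1))) 1,
      x ∈ U i ∧ -x ∈ U i := by
  classical
  by_contra hcon
  push Not at hcon
  have hc : ∀ i, ∀ x : Eu n, ‖x‖ = 1 → x ∈ U i → -x ∉ U i := fun i x hx =>
    hcon i x (by simpa using hx)
  obtain ⟨σ, hσ⟩ := exists_sign n
  let s : Fin n → Eu n → ZMod 2 := fun i x =>
    if x ∈ U i.castSucc then 1 else if -x ∈ U i.castSucc then 0 else σ x
  have hs : ∀ i, ∀ x : Eu n, ‖x‖ = 1 → s i (-x) = s i x + 1 := by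
    intro i x hx
    simp only [s, neg_neg]
    by_cases h1 : x ∈ U i.castSucc
    · have h2 := hc _ x hx h1
      simp [h1, h2, two]
    · by_cases h2 : -x ∈ U i.castSucc
      · simp [h1, h2]
      · simp [h1, h2, hσ x hx]
  let W : Fin n × Bool → Set (Eu n) := fun p =>
    if p.2 then U p.1.castSucc else (fun x => -x) ⁻¹' U p.1.castSucc
  have hWo : ∀ p, IsOpen (W p) := by
    rintro ⟨i, b⟩
    cases b
    · exact (hU _).preimage continuous_neg
    · exact hU _
  have hWc : Metric.sphere (0 : Eu n) 1 ⊆ ⋃ p, W p := by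
    intro x hx
    have hx1 : ‖x‖ = 1 := by simpa using hx
    obtain ⟨i, hi⟩ := Set.mem_iUnion.1 (hcover hx)
    obtain ⟨j, hj⟩ := Set.mem_iUnion.1 (hcover (show -x ∈ _ by simpa using hx1))
    rw [Set.mem_iUnion]
    induction i using Fin.lastCases with
    | cast i => exact ⟨(i, true), hi⟩
    | last =>
      induction j using Fin.lastCases with
      | cast j => exact ⟨(j, false), hj⟩
      | last => exact absurd hj (hc _ x hx1 hi)
  obtain ⟨δ, hδ, hL⟩ := lebesgue_number_lemma_of_metric (isCompact_sphere (0 : Eu n) 1) hWo hWc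
  obtain ⟨N, hN⟩ := exists_nat_gt (n * Real.pi / δ)
  have hN0 : (0 : ℝ) < N := lt_of_le_of_lt (by positivity) hN
  have hNp : 0 < N := by exact_mod_cast hN0
  have hNd : n * (Real.pi / N) < δ := by
    rw [div_lt_iff₀ hδ] at hN
    rw [← mul_div_assoc, div_lt_iff₀ hN0]
    linarith
  have h1 := hemi_cup n N hNp (List.ofFn s) (by simp) (by
    intro t ht
    obtain ⟨i, rfl⟩ := List.mem_ofFn.1 ht
    exact hs i)
  rw [List.length_ofFn] at h1
  have h0 : hemi n N n (cup (List.ofFn s)) = hemi n N n (fun _ => 0) := by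
    refine hemi_congr n N n le_rfl _ _ fun l hl => ?_
    match l with
    | [] => cases (List.ofFn s) <;> simp [cup]
    | x :: l =>
      obtain ⟨⟨i, b⟩, hb⟩ := hL x (by simpa using (hl.1 x (by simp)).1)
      have hm : ∀ y ∈ x :: l, y ∈ W (i, b) := fun y hy => hb (by
        rw [Metric.mem_ball, dist_eq_norm]
        exact (hl.2 y hy x (by simp)).trans_lt hNd)
      refine cup_zero _ _ ⟨s i, List.mem_ofFn.2 ⟨i, rfl⟩, ?_⟩
      have hv : ∀ y ∈ x :: l, s i y = if b then 1 else 0 := by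
        intro y hy
        have hy' := hm y hy
        cases b
        · have h2 : -y ∈ U i.castSucc := hy'
          have h3 : y ∉ U i.castSucc := fun h => hc _ y (hl.1 y hy).1 h h2
          simp [s, h2, h3]
        · have h2 : y ∈ U i.castSucc := hy'
          simp [s, h2]
      intro y hy z hz
      rw [hv y hy, hv z hz]
  have h2 : hemi n N n (fun _ => 0) = 0 := by
    have := hemi_add n N n (fun _ => 0) (fun _ => 0)
    rw [two] at this
    simpa using this
  rw [h0, h2] at h1
  exact zero_ne_one h1
end
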